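/- arXiv:2103.10185 — 2 statements merged into one kernel-verified Lean document; each statement's English description precedes it below -/
import Mathlib

section
/- For every real x ≥ 0, one has 0 ≤ x/√(2π) − (Φ(x/2) − Φ(−x/2)) ≤ x³/(12√(2π)). -/
open MeasureTheory Real

/-- The standard normal cumulative distribution function
`Φ(x) = (1/√(2π)) ∫_{−∞}^x e^{−u²/2} du`. -/
noncomputable def stdNormalCDF (x : ℝ) : ℝ :=
  (Real.sqrt (2 * Real.pi))⁻¹ * ∫ u in Set.Iic x, Real.exp (-u ^ 2 / 2)

theorem integrable_exp_neg_sq_div_two : Integrable fun u : ℝ => exp (-u ^ 2 / 2) := by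
  convert integrable_exp_neg_mul_sq (b := 1 / 2) (by norm_num) using 3
  ring

theorem stdNormalCDF_sub (a b : ℝ) :
    stdNormalCDF b - stdNormalCDF a = (√(2 * π))⁻¹ * ∫ u in a..b, exp (-u ^ 2 / 2) := by
  rw [stdNormalCDF, stdNormalCDF, ← mul_sub, intervalIntegral.integral_Iic_sub_Iic
    integrable_exp_neg_sq_div_two.integrableOn integrable_exp_neg_sq_div_two.integrableOn]

theorem integral_exp_neg_sq_div_two_le {a b : ℝ} (h : a ≤ b) :
    ∫ u in a..b, exp (-u ^ 2 / 2) ≤ b - a := by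
  calc ∫ u in a..b, exp (-u ^ 2 / 2) ≤ ∫ _ in a..b, (1 : ℝ) :=
        intervalIntegral.integral_mono_on h integrable_exp_neg_sq_div_two.intervalIntegrable
          intervalIntegrable_const fun u _ => exp_le_one_iff.2 (by nlinarith [sq_nonneg u])
    _ = b - a := by simp

theorem le_integral_exp_neg_sq_div_two {a b : ℝ} (h : a ≤ b) :
    b - a - (b ^ 3 - a ^ 3) / 6 ≤ ∫ u in a..b, exp (-u ^ 2 / 2) := by
  calc b - a - (b ^ 3 - a ^ 3) / 6 = ∫ u in a..b, (1 - u ^ 2 / 2) := by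
        rw [intervalIntegral.integral_sub (by simp)
          (Continuous.intervalIntegrable (by fun_prop) _ _)]
        simp only [intervalIntegral.integral_div, integral_pow, intervalIntegral.integral_const,
          smul_eq_mul]
        norm_num
        ring
    _ ≤ ∫ u in a..b, exp (-u ^ 2 / 2) :=
        intervalIntegral.integral_mono_on h (Continuous.intervalIntegrable (by fun_prop) _ _)
          integrable_exp_neg_sq_div_two.intervalIntegrable
          fun u _ => by linarith [add_one_le_exp (-u ^ 2 / 2)]

/-- For every real `x ≥ 0`,
`0 ≤ x/√(2π) − (Φ(x/2) − Φ(−x/2)) ≤ x³/(12√(2π))`. -/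
theorem schachermayer_teichmann_core (x : ℝ) (hx : 0 ≤ x) :
    0 ≤ x / Real.sqrt (2 * Real.pi) - (stdNormalCDF (x / 2) - stdNormalCDF (-(x / 2))) ∧
    x / Real.sqrt (2 * Real.pi) - (stdNormalCDF (x / 2) - stdNormalCDF (-(x / 2)))
      ≤ x ^ 3 / (12 * Real.sqrt (2 * Real.pi)) := by
  have hs : 0 < √(2 * π) := by positivity
  have h : -(x / 2) ≤ x / 2 := by linarith
  have hU := integral_exp_neg_sq_div_two_le h
  have hL := le_integral_exp_neg_sq_div_two h
  rw [stdNormalCDF_sub, inv_mul_eq_div, ← sub_div, ← div_div (x ^ 3)]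
  refine ⟨div_nonneg (by linarith) hs.le, ?_⟩
  gcongr
  nlinarith [pow_nonneg hx 3]
end

section
/- Let G be a standard normal random variable, Z₀ > 0, σ > 0 and τ ≥ 0. Then 0 ≤ E[max(σ√τ Z₀ G, 0)] − Z₀ E[max(e^{σ√τ G − σ²τ/2} − 1, 0)] ≤ (Z₀/(12√(2π))) σ³ τ^{3/2}. -/
open MeasureTheory Real ProbabilityTheory

lemma integral_Ioi_id_mul_gaussianPDFReal :
    ∫ x in Set.Ioi (0 : ℝ), x * gaussianPDFReal 0 1 x = (√(2 * π))⁻¹ := by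
  have h := integral_rpow_mul_exp_neg_mul_rpow (p := 2) (q := 1) (b := 1 / 2)
    (by norm_num) (by norm_num) (by norm_num)
  norm_num [rpow_neg_one] at h
  calc ∫ x in Set.Ioi (0 : ℝ), x * gaussianPDFReal 0 1 x
      = ∫ x in Set.Ioi (0 : ℝ), (√(2 * π))⁻¹ * (x * exp (-(1 / 2 * x ^ 2))) := by
        congr 1 with x
        simp only [gaussianPDFReal, NNReal.coe_one, mul_one, sub_zero]
        ring_nf
    _ = (√(2 * π))⁻¹ := by
        rw [integral_const_mul, h, mul_one]

/-- At-the-money Bachelier price with zero interest rate. -/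
lemma integral_max_mul_gaussianReal {a : ℝ} (ha : 0 ≤ a) :
    ∫ x, max (a * x) 0 ∂gaussianReal 0 1 = a * (√(2 * π))⁻¹ := by
  rw [integral_gaussianReal_eq_integral_smul one_ne_zero, ← integral_Ioi_id_mul_gaussianPDFReal,
    ← integral_const_mul, ← integral_indicator measurableSet_Ioi]
  congr 1 with x
  by_cases hx : 0 < x
  · rw [Set.indicator_of_mem (Set.mem_Ioi.2 hx), max_eq_left (by positivity), smul_eq_mul]
    ring
  · rw [Set.indicator_of_notMem (by simpa using hx),
      max_eq_right (mul_nonpos_of_nonneg_of_nonpos ha (not_lt.1 hx)), smul_zero]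

lemma setIntegral_Ioi_comp_sub_right (f : ℝ → ℝ) (a s : ℝ) :
    ∫ x in Set.Ioi a, f (x - s) = ∫ x in Set.Ioi (a - s), f x := by
  rw [← integral_indicator measurableSet_Ioi, ← integral_indicator measurableSet_Ioi,
    ← integral_sub_right_eq_self ((Set.Ioi (a - s)).indicator f) s]
  congr 1 with x
  simp [Set.indicator_apply]

lemma gaussianPDFReal_mul_exp_sub_one (s x : ℝ) :
    gaussianPDFReal 0 1 x * (exp (s * x - s ^ 2 / 2) - 1)
      = gaussianPDFReal 0 1 (x - s) - gaussianPDFReal 0 1 x := by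
  simp only [gaussianPDFReal, NNReal.coe_one, mul_one, sub_zero]
  rw [mul_sub, mul_assoc, ← exp_add, mul_one]
  ring_nf

/-- At-the-money Black–Scholes price with zero interest rate, as an integral of the normal
density over a symmetric interval. -/
lemma integral_max_exp_sub_one_gaussianReal {s : ℝ} (hs : 0 ≤ s) :
    ∫ x, max (exp (s * x - s ^ 2 / 2) - 1) 0 ∂gaussianReal 0 1
      = ∫ x in (-(s / 2))..(s / 2), gaussianPDFReal 0 1 x := by
  have hint := integrable_gaussianPDFReal 0 1
  have key : ∀ x, gaussianPDFReal 0 1 x • max (exp (s * x - s ^ 2 / 2) - 1) 0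
      = (Set.Ioi (s / 2)).indicator
        (fun x ↦ gaussianPDFReal 0 1 (x - s) - gaussianPDFReal 0 1 x) x := by
    intro x
    by_cases hx : s / 2 < x
    · have : 0 ≤ s * x - s ^ 2 / 2 := by nlinarith
      rw [Set.indicator_of_mem (Set.mem_Ioi.2 hx),
        max_eq_left (sub_nonneg.2 (one_le_exp this)), smul_eq_mul,
        gaussianPDFReal_mul_exp_sub_one]
    · have : s * x - s ^ 2 / 2 ≤ 0 := by nlinarith
      rw [Set.indicator_of_notMem (by simpa using hx),
        max_eq_right (sub_nonpos.2 (exp_le_one_iff.2 this)), smul_zero]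
  rw [integral_gaussianReal_eq_integral_smul one_ne_zero, integral_congr_ae (ae_of_all _ key),
    integral_indicator measurableSet_Ioi,
    integral_sub (hint.comp_sub_right s).integrableOn hint.integrableOn,
    setIntegral_Ioi_comp_sub_right, show s / 2 - s = -(s / 2) by ring,
    intervalIntegral.integral_Ioi_sub_Ioi hint.integrableOn (by linarith)]

lemma gaussianPDFReal_le (x : ℝ) : gaussianPDFReal 0 1 x ≤ (√(2 * π))⁻¹ := by
  simp only [gaussianPDFReal, NNReal.coe_one, mul_one, sub_zero]
  exact mul_le_of_le_one_right (by positivity) (exp_le_one_iff.2 (by nlinarith [sq_nonneg x]))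

lemma le_gaussianPDFReal (x : ℝ) :
    (√(2 * π))⁻¹ * (1 - x ^ 2 / 2) ≤ gaussianPDFReal 0 1 x := by
  simp only [gaussianPDFReal, NNReal.coe_one, mul_one, sub_zero]
  gcongr
  linarith [add_one_le_exp (-x ^ 2 / 2)]

lemma integral_gaussianPDFReal_le {s : ℝ} (hs : 0 ≤ s) :
    ∫ x in (-(s / 2))..(s / 2), gaussianPDFReal 0 1 x ≤ s * (√(2 * π))⁻¹ := by
  calc ∫ x in (-(s / 2))..(s / 2), gaussianPDFReal 0 1 x
      ≤ ∫ _ in (-(s / 2))..(s / 2), (√(2 * π))⁻¹ :=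
        intervalIntegral.integral_mono (by linarith)
          (integrable_gaussianPDFReal 0 1).intervalIntegrable (by simp) gaussianPDFReal_le
    _ = s * (√(2 * π))⁻¹ := by
        rw [intervalIntegral.integral_const, smul_eq_mul]
        ring

lemma le_integral_gaussianPDFReal {s : ℝ} (hs : 0 ≤ s) :
    (√(2 * π))⁻¹ * (s - s ^ 3 / 24) ≤ ∫ x in (-(s / 2))..(s / 2), gaussianPDFReal 0 1 x := by
  have hcont : Continuous fun x : ℝ ↦ (√(2 * π))⁻¹ * (1 - x ^ 2 / 2) := by fun_prop
  calc (√(2 * π))⁻¹ * (s - s ^ 3 / 24)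
      = ∫ x in (-(s / 2))..(s / 2), (√(2 * π))⁻¹ * (1 - x ^ 2 / 2) := by
        rw [intervalIntegral.integral_const_mul, intervalIntegral.integral_sub (by simp)
          (by apply Continuous.intervalIntegrable; fun_prop), intervalIntegral.integral_div,
          integral_pow, intervalIntegral.integral_const, smul_eq_mul]
        ring
    _ ≤ _ := intervalIntegral.integral_mono (by linarith) (hcont.intervalIntegrable _ _)
          (integrable_gaussianPDFReal 0 1).intervalIntegrable le_gaussianPDFReal

/-- Schachermayer–Teichmann inequality: for a standard normal `G`, `Z₀ > 0`, `σ > 0`,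
`τ ≥ 0`,
`0 ≤ E[max(σ√τ Z₀ G, 0)] − Z₀ E[max(e^{σ√τ G − σ²τ/2} − 1, 0)]
   ≤ (Z₀/(12√(2π))) σ³ τ^{3/2}`. -/
theorem bachelier_vs_blackScholes {Ω : Type*} [MeasurableSpace Ω] (P : Measure Ω)
    [IsProbabilityMeasure P] (G : Ω → ℝ) (hG : Measure.map G P = gaussianReal 0 1)
    (Z₀ σ τ : ℝ) (hZ₀ : 0 < Z₀) (hσ : 0 < σ) (hτ : 0 ≤ τ) :
    0 ≤ (∫ ω, max (σ * Real.sqrt τ * Z₀ * G ω) 0 ∂P)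
        - Z₀ * ∫ ω, max (Real.exp (σ * Real.sqrt τ * G ω - σ ^ 2 * τ / 2) - 1) 0 ∂P ∧
    (∫ ω, max (σ * Real.sqrt τ * Z₀ * G ω) 0 ∂P)
        - Z₀ * ∫ ω, max (Real.exp (σ * Real.sqrt τ * G ω - σ ^ 2 * τ / 2) - 1) 0 ∂P
      ≤ Z₀ / (12 * Real.sqrt (2 * Real.pi)) * σ ^ 3 * τ ^ ((3 : ℝ) / 2) := by
  have hGm : AEMeasurable G P := by
    apply AEMeasurable.of_map_ne_zero
    rw [hG]
    exact IsProbabilityMeasure.ne_zero _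
  set s := σ * √τ with hs
  have hs0 : 0 ≤ s := by positivity
  have hs2 : σ ^ 2 * τ = s ^ 2 := by rw [hs, mul_pow, sq_sqrt hτ]
  have hs3 : σ ^ 3 * τ ^ ((3 : ℝ) / 2) = s ^ 3 := by
    rw [hs, mul_pow, sqrt_eq_rpow, ← rpow_natCast (τ ^ _), ← rpow_mul hτ]
    norm_num
  have hB : ∫ ω, max (s * Z₀ * G ω) 0 ∂P = s * Z₀ * (√(2 * π))⁻¹ := by
    rw [← integral_max_mul_gaussianReal (by positivity : 0 ≤ s * Z₀), ← hG,
      integral_map hGm (by fun_prop)]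
  have hBS : ∫ ω, max (exp (s * G ω - s ^ 2 / 2) - 1) 0 ∂P
      = ∫ x in (-(s / 2))..(s / 2), gaussianPDFReal 0 1 x := by
    rw [← integral_max_exp_sub_one_gaussianReal hs0, ← hG, integral_map hGm (by fun_prop)]
  rw [mul_assoc (Z₀ / _), hs3, hs2, hB, hBS]
  have hupper := mul_le_mul_of_nonneg_left (integral_gaussianPDFReal_le hs0) hZ₀.le
  have hlower := mul_le_mul_of_nonneg_left (le_integral_gaussianPDFReal hs0) hZ₀.le
  have hpos : 0 ≤ Z₀ * (√(2 * π))⁻¹ * s ^ 3 := by positivity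
  have hrhs : Z₀ / (12 * √(2 * π)) * s ^ 3 = Z₀ * (√(2 * π))⁻¹ * s ^ 3 / 12 := by
    field_simp
  rw [hrhs]
  constructor <;> nlinarith
end
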